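/- Given a finite oracle state ρ^O (a density matrix indexed by oracle values), a finite index set of measurement outcomes a with associated Hermitian cost operators A_a ≥ 0, the semidefinite program minimizing Σ_a tr(σ_a A_a) subject to σ_a ≥ 0 for all a and Σ_a σ_a = ρ^O attains its minimum, and this minimum equals the minimum over POVMs {P_a} on any purifying system QA of Σ_a tr(A_a tr_{QA}((1⊗P_a) ρ^{OQA})), where ρ^{OQA} is any fixed purification of ρ^O. -/

import Mathlib

open Matrix Kronecker BigOperators
open scoped ComplexOrder

/-- Partial trace over the second (purifying) system. -/
noncomputable def ptraceQ {O Q : Type*} [Fintype Q]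
    (M : Matrix (O × Q) (O × Q) ℂ) : Matrix O O ℂ :=
  Matrix.of fun i j => ∑ k : Q, M (i, k) (j, k)

lemma psd_factor {n : Type*} [Fintype n] {M : Matrix n n ℂ} (h : M.PosSemidef) :
    ∃ (m : ℕ) (C : Matrix n (Fin m) ℂ), M = C * Cᴴ := by
  obtain ⟨m, v, rfl⟩ := Matrix.posSemidef_iff_eq_sum_vecMulVec.mp h
  refine ⟨m, Matrix.of fun i k => v k i, ?_⟩
  ext i j
  simp [Matrix.sum_apply, Matrix.mul_apply, vecMulVec_apply]

lemma psd_pinv {n : Type*} [Fintype n] [DecidableEq n] {M : Matrix n n ℂ}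
    (h : M.IsHermitian) : ∃ G : Matrix n n ℂ, Gᴴ = G ∧ M * G * M = M := by
  have hs := h.spectral_theorem
  set φ := Unitary.conjStarAlgAut ℂ (Matrix n n ℂ) h.eigenvectorUnitary
  refine ⟨φ (diagonal fun i => ((h.eigenvalues i)⁻¹ : ℂ)), ?_, ?_⟩
  · rw [← star_eq_conjTranspose, ← map_star, star_eq_conjTranspose, diagonal_conjTranspose]
    congr 2
    ext i
    simp
  · generalize h.eigenvalues = e at *
    rw [hs, ← map_mul, ← map_mul, diagonal_mul_diagonal, diagonal_mul_diagonal]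
    congr 2
    ext i
    by_cases hi : e i = 0
    · simp [hi]
    · have : (e i : ℂ) ≠ 0 := by exact_mod_cast hi
      simp [this]

lemma psd_kill {n ι : Type*} [Fintype n] [Fintype ι] {σ : ι → Matrix n n ℂ}
    (hσ : ∀ a, (σ a).PosSemidef) (N : Matrix n n ℂ) (hN : N * (∑ a, σ a) = 0) (a : ι) :
    N * σ a = 0 := by
  have h0 : ∑ a, (N * σ a * Nᴴ).trace = 0 := by
    rw [← trace_sum, ← Finset.sum_mul, ← Finset.mul_sum, hN]; simp
  have hp : ∀ a, (N * σ a * Nᴴ).PosSemidef := fun a => (hσ a).mul_mul_conjTranspose_same N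
  have h1 := (Finset.sum_eq_zero_iff_of_nonneg (fun a _ => (hp a).trace_nonneg)).1 h0 a
    (Finset.mem_univ a)
  rw [(hp a).trace_eq_zero_iff] at h1
  obtain ⟨m, C, hC⟩ := psd_factor (hσ a)
  rw [hC] at h1 ⊢
  have h2 : (N * C) * (N * C)ᴴ = 0 := by
    rw [conjTranspose_mul, ← h1]; simp only [Matrix.mul_assoc]
  rw [self_mul_conjTranspose_eq_zero] at h2
  rw [← Matrix.mul_assoc, h2, Matrix.zero_mul]

lemma psd_entry {n : Type*} [Fintype n] {M : Matrix n n ℂ} (h : M.PosSemidef) (i j : n) :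
    ‖M i j‖ ≤ M.trace.re := by
  obtain ⟨m, C, rfl⟩ := psd_factor h
  have hd : ∀ i, ((C * Cᴴ) i i).re = ∑ k, ‖C i k‖ ^ 2 := by
    intro i
    simp only [Matrix.mul_apply, conjTranspose_apply, Complex.re_sum]
    refine Finset.sum_congr rfl fun k _ => ?_
    rw [Complex.star_def, Complex.mul_conj, Complex.ofReal_re, Complex.normSq_eq_norm_sq]
  have ht : ∀ i, ((C * Cᴴ) i i).re ≤ (C * Cᴴ).trace.re := by
    intro i
    rw [trace, Complex.re_sum]
    exact Finset.single_le_sum (f := fun i => ((C * Cᴴ) i i).re)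
      (fun i _ => by simp only [hd]; positivity) (Finset.mem_univ i)
  have h1 : ‖(C * Cᴴ) i j‖ ≤ ∑ k, (‖C i k‖ ^ 2 + ‖C j k‖ ^ 2) / 2 := by
    rw [Matrix.mul_apply]
    refine (norm_sum_le _ _).trans (Finset.sum_le_sum fun k _ => ?_)
    rw [conjTranspose_apply, norm_mul, norm_star]
    nlinarith [sq_nonneg (‖C i k‖ - ‖C j k‖)]
  rw [← Finset.sum_div, Finset.sum_add_distrib, ← hd, ← hd] at h1
  linarith [ht i, ht j]

lemma psd_closed {n : Type*} [Fintype n] : IsClosed {M : Matrix n n ℂ | M.PosSemidef} := by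
  have : {M : Matrix n n ℂ | M.PosSemidef} =
      {M | Mᴴ = M} ∩ ⋂ x : n → ℂ, {M | 0 ≤ star x ⬝ᵥ (M *ᵥ x)} := by
    ext M
    simp [posSemidef_iff_dotProduct_mulVec, IsHermitian]
  rw [this]
  refine (isClosed_eq (by fun_prop) (by fun_prop)).inter (isClosed_iInter fun x => ?_)
  exact isClosed_le continuous_const (by fun_prop)

lemma sdp_attains {O ι : Type*} [Fintype O] [Fintype ι] [Nonempty ι]
    (ρ : Matrix O O ℂ) (hρ : ρ.PosSemidef) (A : ι → Matrix O O ℂ) :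
    ∃ c : ℝ, IsLeast {x : ℝ | ∃ σ : ι → Matrix O O ℂ,
          (∀ a, (σ a).PosSemidef) ∧ (∑ a, σ a = ρ) ∧
          x = (∑ a, ((σ a) * (A a)).trace).re} c := by
  classical
  set S : Set (ι → Matrix O O ℂ) := {σ | (∀ a, (σ a).PosSemidef) ∧ ∑ a, σ a = ρ} with hS
  have hne : S.Nonempty := by
    obtain ⟨a0⟩ := ‹Nonempty ι›
    refine ⟨Pi.single a0 ρ, fun a => ?_, by simp⟩
    by_cases h : a = a0
    · subst h; simpa using hρ
    · simpa [h] using PosSemidef.zero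
  have hcl : IsClosed S := by
    have : S = (⋂ a, (fun σ : ι → Matrix O O ℂ => σ a) ⁻¹' {M | M.PosSemidef}) ∩
        {σ | ∑ a, σ a = ρ} := by
      ext σ; simp [hS]
    rw [this]
    exact (isClosed_iInter fun a => psd_closed.preimage (continuous_apply a)).inter
      (isClosed_eq (by fun_prop) (by fun_prop))
  have hK : IsCompact (Set.pi Set.univ fun _ : ι => Set.pi Set.univ fun _ : O =>
      Set.pi Set.univ fun _ : O => Metric.closedBall (0 : ℂ) ρ.trace.re) :=
    isCompact_univ_pi fun _ => isCompact_univ_pi fun _ => isCompact_univ_pi fun _ =>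
      isCompact_closedBall _ _
  have hc : IsCompact S := by
    refine IsCompact.of_isClosed_subset hK hcl ?_
    rintro σ ⟨h1, h2⟩ a - i - j -
    rw [mem_closedBall_zero_iff]
    refine (psd_entry (h1 a) i j).trans ?_
    rw [← h2, trace_sum, Complex.re_sum]
    exact Finset.single_le_sum (f := fun a => (σ a).trace.re)
      (fun a _ => (Complex.nonneg_iff.1 (h1 a).trace_nonneg).1) (Finset.mem_univ a)
  have hf : Continuous fun σ : ι → Matrix O O ℂ => (∑ a, ((σ a) * (A a)).trace).re := by
    fun_prop
  obtain ⟨σ, hσ, hmin⟩ := hc.exists_isMinOn hne hf.continuousOn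
  refine ⟨_, ⟨σ, hσ.1, hσ.2, rfl⟩, ?_⟩
  rintro x ⟨τ, h1, h2, rfl⟩
  exact hmin (show τ ∈ S from ⟨h1, h2⟩)

lemma ptrace_formula {O QA : Type*} [Fintype O] [Fintype QA] [DecidableEq O]
    (v : O × QA → ℂ) (P : Matrix QA QA ℂ) :
    ptraceQ (((1 : Matrix O O ℂ) ⊗ₖ P) * Matrix.of fun i j => v i * (starRingEnd ℂ) (v j)) =
      (Matrix.of fun i k => v (i, k)) * Pᵀ * (Matrix.of fun i k => v (i, k))ᴴ := by
  ext i j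
  simp only [ptraceQ, of_apply, Matrix.mul_apply, kroneckerMap_apply, Fintype.sum_prod_type,
    transpose_apply, conjTranspose_apply, one_apply, ite_mul, one_mul, zero_mul]
  refine Finset.sum_congr rfl fun k _ => ?_
  rw [Finset.sum_eq_single i (by intro b _ hb; simp [hb.symm]) (by simp), Finset.sum_mul]
  refine Finset.sum_congr rfl fun l _ => ?_
  simp only [if_true, Complex.star_def]
  ring

lemma remote_prep {O QA ι : Type*} [Fintype O] [Fintype QA] [Fintype ι] [Nonempty ι]
    [DecidableEq O] [DecidableEq QA] (V : Matrix O QA ℂ) (σ : ι → Matrix O O ℂ)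
    (h1 : ∀ a, (σ a).PosSemidef) (h2 : ∑ a, σ a = V * Vᴴ) :
    ∃ P : ι → Matrix QA QA ℂ, (∀ a, (P a).PosSemidef) ∧ ∑ a, P a = 1 ∧
      ∀ a, V * P a * Vᴴ = σ a := by
  classical
  obtain ⟨G, hG, hG2⟩ := psd_pinv (isHermitian_mul_conjTranspose_self V)
  obtain ⟨a0⟩ := ‹Nonempty ι›
  set W := Vᴴ * G with hW
  have hN : (1 - V * W) * (V * Vᴴ) = 0 := by
    rw [Matrix.sub_mul, Matrix.one_mul, sub_eq_zero, hW, ← Matrix.mul_assoc V, hG2]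
  have hVW : V * W * V = V := by
    have := (mul_self_mul_conjTranspose_eq_zero V (1 - V * W)).1 (by rw [hN])
    rw [Matrix.sub_mul, Matrix.one_mul, sub_eq_zero] at this
    exact this.symm
  have hσ : ∀ a, V * W * σ a = σ a := fun a => by
    have := psd_kill h1 (1 - V * W) (by rw [h2, hN]) a
    rw [Matrix.sub_mul, Matrix.one_mul, sub_eq_zero] at this
    exact this.symm
  have hσ' : ∀ a, σ a * (Wᴴ * Vᴴ) = σ a := fun a => by
    have := congrArg conjTranspose (hσ a)
    rwa [conjTranspose_mul, conjTranspose_mul, (h1 a).isHermitian.eq] at this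
  have hH : (W * V)ᴴ = W * V := by
    rw [hW]; simp [conjTranspose_mul, hG, Matrix.mul_assoc]
  have hI : W * V * (W * V) = W * V := by
    rw [Matrix.mul_assoc W, ← Matrix.mul_assoc V, hVW]
  have hE : (1 - W * V).PosSemidef := by
    have := posSemidef_self_mul_conjTranspose (1 - W * V)
    rwa [conjTranspose_sub, conjTranspose_one, hH, Matrix.mul_sub, Matrix.sub_mul, Matrix.sub_mul,
      hI, Matrix.one_mul, Matrix.one_mul, Matrix.mul_one, sub_self, sub_zero] at this
  refine ⟨fun a => W * σ a * Wᴴ + if a = a0 then 1 - W * V else 0, fun a => ?_, ?_, fun a => ?_⟩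
  · refine ((h1 a).mul_mul_conjTranspose_same W).add ?_
    split_ifs
    · exact hE
    · exact PosSemidef.zero
  · rw [Finset.sum_add_distrib, ← Matrix.sum_mul, ← Matrix.mul_sum, h2]
    have : W * (V * Vᴴ) * Wᴴ = W * V := by
      rw [← Matrix.mul_assoc, Matrix.mul_assoc, ← conjTranspose_mul, hH, hI]
    simp [this]
  · have h3 : V * (W * σ a * Wᴴ) * Vᴴ = σ a := by
      calc _ = (V * W * σ a) * (Wᴴ * Vᴴ) := by simp only [Matrix.mul_assoc]
        _ = _ := by rw [hσ, hσ']
    have h4 : V * (1 - W * V) = 0 := by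
      rw [Matrix.mul_sub, Matrix.mul_one, ← Matrix.mul_assoc, hVW, sub_self]
    rw [Matrix.mul_add, Matrix.add_mul, h3]
    split_ifs <;> simp [h4]

/-- The measurement SDP attains its minimum, and this minimum equals the minimum over
POVMs on a purifying system of the expected cost of the induced conditional states. -/
theorem measurement_sdp_eq_povm_optimum
    {O QA ι : Type*} [Fintype O] [Fintype QA] [Fintype ι] [Nonempty ι]
    [DecidableEq O] [DecidableEq QA]
    (ρ : Matrix O O ℂ) (hρ : ρ.PosSemidef) (hρtr : ρ.trace = 1)
    (A : ι → Matrix O O ℂ) (hA : ∀ a, (A a).PosSemidef)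
    (v : O × QA → ℂ)
    (ρOQA : Matrix (O × QA) (O × QA) ℂ)
    (hpure : ρOQA = Matrix.of fun i j => v i * (starRingEnd ℂ) (v j))
    (hpurif : ptraceQ ρOQA = ρ) :
    ∃ c : ℝ,
      IsLeast {x : ℝ | ∃ σ : ι → Matrix O O ℂ,
          (∀ a, (σ a).PosSemidef) ∧ (∑ a, σ a = ρ) ∧
          x = (∑ a, ((σ a) * (A a)).trace).re} c ∧
      IsLeast {x : ℝ | ∃ P : ι → Matrix QA QA ℂ,
          (∀ a, (P a).PosSemidef) ∧ (∑ a, P a = 1) ∧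
          x = (∑ a, ((A a) * ptraceQ (((1 : Matrix O O ℂ) ⊗ₖ P a) * ρOQA)).trace).re} c := by
  obtain ⟨c, hc⟩ := sdp_attains ρ hρ A
  refine ⟨c, hc, ?_⟩
  convert hc using 1
  subst hpure
  have hV : ρ = (Matrix.of fun i k => v (i, k)) * (Matrix.of fun i k => v (i, k))ᴴ := by
    rw [← hpurif]
    ext i j
    simp [ptraceQ, Matrix.mul_apply]
  simp only [ptrace_formula]
  ext x
  constructor
  · rintro ⟨P, h1, h2, rfl⟩
    refine ⟨fun a => (Matrix.of fun i k => v (i, k)) * (P a)ᵀ * (Matrix.of fun i k => v (i, k))ᴴ,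
      fun a => (h1 a).transpose.mul_mul_conjTranspose_same _, ?_, ?_⟩
    · rw [← Matrix.sum_mul, ← Matrix.mul_sum, ← transpose_sum, h2, transpose_one, Matrix.mul_one,
        hV]
    · simp only [trace_mul_comm (A _)]
  · rintro ⟨σ, h1, h2, rfl⟩
    obtain ⟨P, p1, p2, p3⟩ := remote_prep _ σ h1 (h2.trans hV)
    refine ⟨fun a => (P a)ᵀ, fun a => (p1 a).transpose, ?_, ?_⟩
    · rw [← transpose_sum, p2, transpose_one]
    · simp only [transpose_transpose, p3, trace_mul_comm (A _)]
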